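/- In one no-equivocation round, for any two distinct messages m1 ≠ m2, it cannot happen that some processor p receives m1 from a strict majority while some processor p' receives m2 from a strict majority. -/

import Mathlib

/-- In one no-equivocation round, for distinct messages `m1 ≠ m2`, it cannot
happen that `p` receives `m1` from a strict majority while `p'` receives `m2` from a
strict majority. -/
theorem stmt_1 {P M : Type*} (rcv : P → P → Option (Option M))
    (hfin : ∀ p : P, {q | rcv p q ≠ none}.Finite)
    (noeq : ∀ p p' q : P, ∀ m m' : M,
      rcv p q = some (some m) → rcv p' q = some (some m') → m = m')
    (fnote : ∀ p p' q : P, ∀ m : M, rcv p q = some (some m) → rcv p' q ≠ none)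
    (m1 m2 : M) (hne : m1 ≠ m2) (p p' : P)
    (h1 : 2 * {q | rcv p q = some (some m1)}.ncard > {q | rcv p q ≠ none}.ncard)
    (h2 : 2 * {q | rcv p' q = some (some m2)}.ncard > {q | rcv p' q ≠ none}.ncard) :
    False := by
  have hd : Disjoint {q | rcv p q = some (some m1)} {q | rcv p' q = some (some m2)} :=
    Set.disjoint_left.mpr fun q ha hb => hne (noeq p p' q m1 m2 ha hb)
  have hsub : ∀ r : P, {q | rcv p q = some (some m1)} ∪ {q | rcv p' q = some (some m2)} ⊆
      {q | rcv r q ≠ none} := by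
    rintro r q (h | h)
    · exact fnote p r q m1 h
    · exact fnote p' r q m2 h
  have hu := Set.ncard_union_eq hd
    ((hfin p).subset (Set.subset_union_left.trans (hsub p)))
    ((hfin p).subset (Set.subset_union_right.trans (hsub p)))
  have k1 := Set.ncard_le_ncard (hsub p) (hfin p)
  have k2 := Set.ncard_le_ncard (hsub p') (hfin p')
  omega
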